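/- Let 1 ≤ k ≤ d−1 and let σ_{k,d} be an O(d)-invariant Borel probability measure on G_{k,d}. There exists a constant C > 0, depending only on d and k, such that for every t ≥ 1, every cubature {(P_j, ω_j)}_{j=1}^n for Hom_t(G_{k,d}) with positive weights ω_j > 0 has covering radius ρ({P_j}_{j=1}^n) ≤ C/t. In particular, any sequence of such cubatures whose cardinalities satisfy n_t ≍ t^{k(d−k)} is an asymptotically optimal covering, i.e. its covering radius satisfies ρ^{(t)} ≍ n_t^{−1/(k(d−k))}. -/

import Mathlib

open Matrix MeasureTheory MvPolynomial

noncomputable instance (d : ℕ) : MeasurableSpace (Matrix (Fin d) (Fin d) ℝ) :=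
  inferInstanceAs (MeasurableSpace (Fin d → Fin d → ℝ))

/-- The Grassmannian `G_{k,d}` of rank-`k` orthogonal projectors in `ℝ^{d×d}`. -/
def Grass (d k : ℕ) : Set (Matrix (Fin d) (Fin d) ℝ) :=
  {P | P.IsSymm ∧ P * P = P ∧ P.trace = k}

lemma conj_mem_Grass {d k : ℕ} {U : Matrix (Fin d) (Fin d) ℝ}
    (hU : U ∈ Matrix.orthogonalGroup (Fin d) ℝ) {P : Matrix (Fin d) (Fin d) ℝ}
    (hP : P ∈ Grass d k) : U * P * Uᵀ ∈ Grass d k := by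
  obtain ⟨hs, hi, ht⟩ := hP
  have hU2 : Uᵀ * U = 1 := by
    have := (Matrix.mem_orthogonalGroup_iff' (Fin d) ℝ).mp hU
    simpa using this
  refine ⟨?_, ?_, ?_⟩
  · unfold Matrix.IsSymm
    simp [Matrix.transpose_mul, hs.eq, Matrix.mul_assoc]
  · calc U * P * Uᵀ * (U * P * Uᵀ) = U * P * (Uᵀ * U) * P * Uᵀ := by
          simp [Matrix.mul_assoc]
    _ = U * (P * P) * Uᵀ := by simp [hU2, Matrix.mul_assoc]
    _ = U * P * Uᵀ := by rw [hi]
  · rw [Matrix.trace_mul_cycle, hU2, Matrix.one_mul, ht]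

/-- The conjugation action `P ↦ U P Uᵀ` of an orthogonal matrix `U` on the Grassmannian. -/
def conjGrass {d k : ℕ} {U : Matrix (Fin d) (Fin d) ℝ}
    (hU : U ∈ Matrix.orthogonalGroup (Fin d) ℝ) (P : Grass d k) : Grass d k :=
  ⟨U * P.val * Uᵀ, conj_mem_Grass hU P.property⟩

/-- `σ` is an `O(d)`-invariant measure on the Grassmannian `G_{k,d}`. -/
def IsOrthInvariant {d k : ℕ} (σ : Measure (Grass d k)) : Prop :=
  ∀ U : Matrix (Fin d) (Fin d) ℝ, ∀ hU : U ∈ Matrix.orthogonalGroup (Fin d) ℝ,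
    Measure.map (conjGrass hU) σ = σ

/-- `{(P j, ω j)}` is a cubature for `Hom_t(G_{k,d})` with respect to `σ`:
for every homogeneous polynomial `p` of degree `t` in the matrix entries, the integral of `p`
over the Grassmannian equals the weighted sum of point evaluations. -/
def IsCubature {d k : ℕ} (σ : Measure (Grass d k)) {n : ℕ}
    (P : Fin n → Grass d k) (ω : Fin n → ℝ) (t : ℕ) : Prop :=
  ∀ p ∈ MvPolynomial.homogeneousSubmodule (Fin d × Fin d) ℝ t,
    ∫ Q : Grass d k, MvPolynomial.eval (fun ij => (Q : Matrix (Fin d) (Fin d) ℝ) ij.1 ij.2) p ∂σ =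
      ∑ j, ω j * MvPolynomial.eval (fun ij => (P j : Matrix (Fin d) (Fin d) ℝ) ij.1 ij.2) p

/-- The Frobenius norm of a matrix. -/
noncomputable def frobNorm {d : ℕ} (A : Matrix (Fin d) (Fin d) ℝ) : ℝ :=
  Real.sqrt (∑ i, ∑ j, (A i j) ^ 2)

/-- The covering radius of the points `P 1, …, P n` in the Grassmannian, with respect to the
Frobenius norm. -/
noncomputable def covRadius {d k n : ℕ} (P : Fin n → Grass d k) : ℝ :=
  ⨆ Q : Grass d k, ⨅ j, frobNorm ((Q : Matrix (Fin d) (Fin d) ℝ) - (P j : Matrix (Fin d) (Fin d) ℝ))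


lemma cc_frob_sq {d : ℕ} (A : Matrix (Fin d) (Fin d) ℝ) :
    frobNorm A ^ 2 = ∑ i, ∑ j, (A i j) ^ 2 := by
  unfold frobNorm
  rw [Real.sq_sqrt]
  positivity

lemma cc_frob_nonneg {d : ℕ} (A : Matrix (Fin d) (Fin d) ℝ) : 0 ≤ frobNorm A :=
  Real.sqrt_nonneg _

lemma cc_frob_sq_trace {d : ℕ} (A : Matrix (Fin d) (Fin d) ℝ) :
    frobNorm A ^ 2 = (Aᵀ * A).trace := by
  rw [cc_frob_sq, Finset.sum_comm]
  simp only [Matrix.trace, Matrix.diag, Matrix.mul_apply, Matrix.transpose_apply, sq]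

lemma cc_frob_norm {d : ℕ} (A : Matrix (Fin d) (Fin d) ℝ) :
    frobNorm A = ‖(WithLp.toLp 2 (fun ij : Fin d × Fin d => A ij.1 ij.2) :
      EuclideanSpace ℝ (Fin d × Fin d))‖ := by
  rw [EuclideanSpace.norm_eq, frobNorm, Fintype.sum_prod_type]
  simp

lemma cc_frob_tri {d : ℕ} (A B C : Matrix (Fin d) (Fin d) ℝ) :
    frobNorm (A - C) ≤ frobNorm (A - B) + frobNorm (B - C) := by
  rw [cc_frob_norm, cc_frob_norm, cc_frob_norm]
  refine le_trans (le_of_eq ?_) (norm_add_le _ _)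
  congr 1
  ext ij
  simp

lemma cc_frob_comm {d : ℕ} (A B : Matrix (Fin d) (Fin d) ℝ) :
    frobNorm (A - B) = frobNorm (B - A) := by
  unfold frobNorm
  congr 1
  refine Finset.sum_congr rfl fun i _ => Finset.sum_congr rfl fun j _ => ?_
  simp only [Matrix.sub_apply]; ring

lemma cc_frob_entry {d : ℕ} (A : Matrix (Fin d) (Fin d) ℝ) (i j : Fin d) :
    |A i j| ≤ frobNorm A := by
  refine abs_le_of_sq_le_sq ?_ (cc_frob_nonneg A)
  rw [cc_frob_sq]
  calc (A i j)^2 ≤ ∑ j, (A i j)^2 :=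
        Finset.single_le_sum (f := fun j => (A i j)^2) (fun _ _ => sq_nonneg _) (Finset.mem_univ j)
    _ ≤ _ := Finset.single_le_sum (f := fun i => ∑ j, (A i j)^2)
        (fun _ _ => by positivity) (Finset.mem_univ i)

lemma cc_dist_sq {d k : ℕ} (P Q : Grass d k) :
    frobNorm (P.val - Q.val) ^ 2 = 2 * k - 2 * (P.val * Q.val).trace := by
  obtain ⟨P, hs, hi, ht⟩ := P
  obtain ⟨Q, hs', hi', ht'⟩ := Q
  rw [cc_frob_sq_trace]
  simp only [Matrix.transpose_sub, hs.eq, hs'.eq, Matrix.sub_mul, Matrix.mul_sub,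
    Matrix.trace_sub, hi, hi', ht, ht', Matrix.trace_mul_comm Q P]
  ring

lemma cc_trace_nonneg {d k : ℕ} (P Q : Grass d k) : 0 ≤ (P.val * Q.val).trace := by
  obtain ⟨P, hs, hi, ht⟩ := P
  obtain ⟨Q, hs', hi', ht'⟩ := Q
  have : (P * Q).trace = frobNorm (P * Q) ^ 2 := by
    rw [cc_frob_sq_trace, Matrix.transpose_mul, hs.eq, hs'.eq, Matrix.mul_assoc,
      ← Matrix.mul_assoc P P Q, hi, ← Matrix.mul_assoc, Matrix.trace_mul_cycle, hi',
      Matrix.trace_mul_comm]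
  simp only [this]
  positivity

lemma cc_dist_sq_le {d k : ℕ} (P Q : Grass d k) :
    frobNorm (P.val - Q.val) ^ 2 ≤ 2 * k := by
  rw [cc_dist_sq]; linarith [cc_trace_nonneg P Q]

/-- normalized squared distance -/
noncomputable def ccU {d k : ℕ} (Q P : Grass d k) : ℝ := frobNorm (P.val - Q.val) ^ 2 / (2 * k)

lemma cc_spec {d k : ℕ} (P : Grass d k) : ∃ (V : Matrix (Fin d) (Fin d) ℝ) (a : Fin d → ℝ),
    V ∈ Matrix.orthogonalGroup (Fin d) ℝ ∧ P.val = V * diagonal a * Vᵀ ∧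
    (∀ i, a i = 0 ∨ a i = 1) ∧ ∑ i, a i = k := by
  obtain ⟨P, hs, hi, ht⟩ := P
  have hH : P.IsHermitian := by
    unfold Matrix.IsHermitian
    rw [Matrix.conjTranspose_eq_transpose_of_trivial]; exact hs
  have hV := hH.eigenvectorUnitary.2
  have hsp : P = (hH.eigenvectorUnitary : Matrix _ _ ℝ) * diagonal hH.eigenvalues *
      (hH.eigenvectorUnitary : Matrix _ _ ℝ)ᵀ := by
    have := hH.spectral_theorem
    rw [Unitary.conjStarAlgAut_apply] at this
    simpa [Matrix.star_eq_conjTranspose, Function.comp_def] using this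
  set V := (hH.eigenvectorUnitary : Matrix (Fin d) (Fin d) ℝ)
  have hV1 : Vᵀ * V = 1 := by
    have := (Matrix.mem_orthogonalGroup_iff' (Fin d) ℝ).mp hV
    simpa using this
  refine ⟨V, hH.eigenvalues, hV, hsp, ?_, ?_⟩
  · have hD : diagonal hH.eigenvalues = Vᵀ * P * V := by
      calc diagonal hH.eigenvalues = (Vᵀ * V) * diagonal hH.eigenvalues * (Vᵀ * V) := by
            rw [hV1]; simp
        _ = Vᵀ * (V * diagonal hH.eigenvalues * Vᵀ) * V := by simp only [Matrix.mul_assoc]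
        _ = _ := by rw [← hsp]
    have hVV : V * Vᵀ = 1 := mul_eq_one_comm.mp hV1
    have hDD : diagonal hH.eigenvalues * diagonal hH.eigenvalues = diagonal hH.eigenvalues := by
      rw [hD]
      calc Vᵀ * P * V * (Vᵀ * P * V) = Vᵀ * P * (V * Vᵀ) * P * V := by
            simp only [Matrix.mul_assoc]
        _ = Vᵀ * (P * P) * V := by rw [hVV]; simp [Matrix.mul_assoc]
        _ = _ := by rw [hi]
    intro i
    rw [Matrix.diagonal_mul_diagonal] at hDD
    have := congrFun (congrFun hDD i) i
    simp only [Matrix.diagonal_apply_eq] at this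
    rcases eq_or_ne (hH.eigenvalues i) 0 with h | h
    · exact Or.inl h
    · right; exact mul_left_cancel₀ h (by simpa using this)
  · have h2 : P.trace = (diagonal hH.eigenvalues).trace := by
      conv_lhs => rw [hsp]
      rw [Matrix.trace_mul_cycle, hV1, Matrix.one_mul]
    rw [Matrix.trace_diagonal] at h2
    rw [← h2, ht]

lemma cc_perm {d : ℕ} (a b : Fin d → ℝ) (ha : ∀ i, a i = 0 ∨ a i = 1)
    (hb : ∀ i, b i = 0 ∨ b i = 1) (hab : ∑ i, a i = ∑ i, b i) :
    ∃ π : Equiv.Perm (Fin d), ∀ i, b (π i) = a i := by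
  classical
  have key : ∀ c : Fin d → ℝ, (∀ i, c i = 0 ∨ c i = 1) →
      ∑ i, c i = (Fintype.card {i // c i = 1} : ℝ) := by
    intro c hc
    rw [Fintype.card_subtype, Finset.card_filter]
    push_cast
    refine Finset.sum_congr rfl fun i _ => ?_
    rcases hc i with h | h <;> simp [h]
  have hcard : Fintype.card {i // a i = 1} = Fintype.card {i // b i = 1} := by
    have := (key a ha).symm.trans (hab.trans (key b hb))
    exact_mod_cast this
  let e := Fintype.equivOfCardEq hcard
  refine ⟨e.extendSubtype, fun i => ?_⟩
  rcases ha i with h | h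
  · have := e.extendSubtype_not_mem i (by rw [h]; norm_num)
    rw [h]; exact (hb _).resolve_right this
  · have := e.extendSubtype_mem i h
    rw [h]; exact this

lemma cc_trans {d k : ℕ} (P Q : Grass d k) : ∃ (U : Matrix (Fin d) (Fin d) ℝ)
    (hU : U ∈ Matrix.orthogonalGroup (Fin d) ℝ), conjGrass hU P = Q := by
  obtain ⟨V, a, hV, hP, ha, has⟩ := cc_spec P
  obtain ⟨W, b, hW, hQ, hb, hbs⟩ := cc_spec Q
  obtain ⟨π, hπ⟩ := cc_perm a b ha hb (has.trans hbs.symm)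
  -- permutation matrix
  have hV1 : Vᵀ * V = 1 := by
    simpa using (Matrix.mem_orthogonalGroup_iff' (Fin d) ℝ).mp hV
  have hV2 : V * Vᵀ = 1 := mul_eq_one_comm.mp hV1
  have hW1 : W * Wᵀ = 1 := by
    simpa using (Matrix.mem_orthogonalGroup_iff (Fin d) ℝ).mp hW
  let W' := W.submatrix id π
  have hW' : W' * W'ᵀ = 1 := by
    ext i j
    rw [← hW1]
    simp only [W', Matrix.mul_apply, Matrix.submatrix_apply, Matrix.transpose_apply, id]
    exact Equiv.sum_comp π (fun x => W i x * W j x)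
  have hQ' : Q.val = W' * diagonal a * W'ᵀ := by
    rw [hQ]
    ext i j
    rw [Matrix.mul_apply, Matrix.mul_apply]
    simp only [Matrix.mul_diagonal, W', Matrix.submatrix_apply, Matrix.transpose_apply, id, ← hπ]
    exact (Equiv.sum_comp π (fun x => W i x * b x * W j x)).symm
  refine ⟨W' * Vᵀ, ?_, ?_⟩
  · rw [Matrix.mem_orthogonalGroup_iff]
    have hst : (W' * Vᵀ)ᵀ = V * W'ᵀ := by
      rw [Matrix.transpose_mul, Matrix.transpose_transpose]
    rw [hst]
    calc W' * Vᵀ * (V * W'ᵀ) = W' * (Vᵀ * V) * W'ᵀ := by simp only [Matrix.mul_assoc]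
      _ = 1 := by rw [hV1, Matrix.mul_one, hW']
  · apply Subtype.ext
    simp only [conjGrass]
    rw [hQ', hP, Matrix.transpose_mul, Matrix.transpose_transpose]
    calc W' * Vᵀ * (V * diagonal a * Vᵀ) * (V * W'ᵀ)
        = W' * (Vᵀ * V) * diagonal a * (Vᵀ * V) * W'ᵀ := by simp only [Matrix.mul_assoc]
      _ = _ := by rw [hV1]; simp

lemma cc_dist_conj {d k : ℕ} {U : Matrix (Fin d) (Fin d) ℝ}
    (hU : U ∈ Matrix.orthogonalGroup (Fin d) ℝ) (P Q : Grass d k) :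
    frobNorm ((conjGrass hU P).val - (conjGrass hU Q).val) = frobNorm (P.val - Q.val) := by
  have h : frobNorm ((conjGrass hU P).val - (conjGrass hU Q).val) ^ 2
      = frobNorm (P.val - Q.val) ^ 2 := by
    rw [cc_dist_sq, cc_dist_sq]
    have hU1 : Uᵀ * U = 1 := by
      simpa using (Matrix.mem_orthogonalGroup_iff' (Fin d) ℝ).mp hU
    have : (conjGrass hU P).val * (conjGrass hU Q).val = U * (P.val * Q.val) * Uᵀ := by
      simp only [conjGrass]
      calc U * P.val * Uᵀ * (U * Q.val * Uᵀ) = U * P.val * (Uᵀ * U) * Q.val * Uᵀ := by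
            simp only [Matrix.mul_assoc]
        _ = _ := by rw [hU1]; simp [Matrix.mul_assoc]
    rw [this, Matrix.trace_mul_cycle, hU1, Matrix.one_mul]
  exact (sq_eq_sq₀ (cc_frob_nonneg _) (cc_frob_nonneg _)).mp h

/-- closed ball -/
def ccB {d k : ℕ} (Q : Grass d k) (r : ℝ) : Set (Grass d k) := {P | frobNorm (P.val - Q.val) ≤ r}

lemma cc_meas_entry {d k : ℕ} (i j : Fin d) : Measurable (fun P : Grass d k => P.val i j) := by
  have h : Measurable (fun P : Matrix (Fin d) (Fin d) ℝ => P i j) :=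
    (measurable_pi_apply j).comp (measurable_pi_apply (X := fun _ : Fin d => Fin d → ℝ) i)
  exact h.comp measurable_subtype_coe

lemma cc_meas_dist {d k : ℕ} (Q : Grass d k) :
    Measurable (fun P : Grass d k => frobNorm (P.val - Q.val)) := by
  unfold frobNorm
  simp only [Matrix.sub_apply]
  refine Measurable.sqrt ?_
  refine Finset.measurable_sum _ fun i _ => Finset.measurable_sum _ fun j _ => ?_
  exact ((cc_meas_entry i j).sub_const _).pow_const 2

lemma cc_meas_ball {d k : ℕ} (Q : Grass d k) (r : ℝ) : MeasurableSet (ccB Q r) :=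
  measurableSet_le (cc_meas_dist Q) measurable_const

lemma cc_meas_conj {d k : ℕ} {U : Matrix (Fin d) (Fin d) ℝ}
    (hU : U ∈ Matrix.orthogonalGroup (Fin d) ℝ) : Measurable (conjGrass (k := k) hU) := by
  refine Measurable.subtype_mk ?_
  refine measurable_pi_lambda (X := fun _ : Fin d => Fin d → ℝ) _ fun i => measurable_pi_lambda _ fun j => ?_
  simp only [Matrix.mul_apply]
  refine Finset.measurable_sum _ fun l _ => Measurable.mul_const ?_ _
  exact Finset.measurable_sum _ fun m _ => (cc_meas_entry m l).const_mul _

lemma cc_ball_eq {d k : ℕ} (σ : Measure (Grass d k)) (hσ : IsOrthInvariant σ)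
    (P Q : Grass d k) (r : ℝ) : σ (ccB P r) = σ (ccB Q r) := by
  obtain ⟨U, hU, rfl⟩ := cc_trans P Q
  conv_rhs => rw [← hσ U hU]
  rw [Measure.map_apply (cc_meas_conj hU) (cc_meas_ball _ _)]
  congr 1
  ext R
  simp only [ccB, Set.mem_ofPred_eq, Set.mem_preimage, cc_dist_conj]

lemma cc_doubling {d k : ℕ} (hd : 0 < d) (σ : Measure (Grass d k)) [IsProbabilityMeasure σ]
    (hσ : IsOrthInvariant σ) : ∃ K : ℕ, 1 ≤ K ∧ ∀ (Q : Grass d k) (r : ℝ), 0 < r →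
      σ.real (ccB Q (2 * r)) ≤ K * σ.real (ccB Q r) := by
  classical
  let I := Finset.Icc (-(2 * d : ℤ)) (2 * d)
  let T := Fin d → Fin d → I
  have : Nonempty I := ⟨⟨0, by simp [I]⟩⟩
  refine ⟨Fintype.card T, Fintype.card_pos, fun Q r hr => ?_⟩
  have hdR : (0 : ℝ) < d := by exact_mod_cast hd
  let cell : T → Set (Grass d k) := fun c =>
    {P | P ∈ ccB Q (2 * r) ∧ ∀ i j, ⌊(P.val i j - Q.val i j) * d / r⌋ = (c i j : ℤ)}
  have hcov : ccB Q (2 * r) ⊆ ⋃ c, cell c := by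
    intro P hP
    have hb : ∀ i j, ⌊(P.val i j - Q.val i j) * d / r⌋ ∈ I := by
      intro i j
      have h1 : |(P.val - Q.val) i j| ≤ 2 * r := (cc_frob_entry _ i j).trans hP
      rw [Matrix.sub_apply, abs_le] at h1
      simp only [I, Finset.mem_Icc]
      constructor
      · rw [Int.le_floor, le_div_iff₀ hr]
        push_cast
        nlinarith
      · have : (P.val i j - Q.val i j) * d / r ≤ ((2 * d : ℤ) : ℝ) := by
          rw [div_le_iff₀ hr]; push_cast; nlinarith
        exact Int.floor_le_iff.mpr (by linarith)
    rw [Set.mem_iUnion]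
    exact ⟨fun i j => ⟨_, hb i j⟩, hP, fun i j => rfl⟩
  have hcell : ∀ c, σ.real (cell c) ≤ σ.real (ccB Q r) := by
    intro c
    rcases (cell c).eq_empty_or_nonempty with h | ⟨P₀, hP₀⟩
    · rw [h]; simp
    · have hsub : cell c ⊆ ccB P₀ r := by
        intro P hP
        have h1 : ∀ i j, ((P.val - P₀.val) i j) ^ 2 ≤ (r / d) ^ 2 := by
          intro i j
          have e := (hP.2 i j).trans (hP₀.2 i j).symm
          have := Int.abs_sub_lt_one_of_floor_eq_floor e
          apply sq_le_sq'
          all_goals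
            rw [Matrix.sub_apply]
            have h2 : (P.val i j - Q.val i j) * d / r - (P₀.val i j - Q.val i j) * d / r
              = (P.val i j - P₀.val i j) * (d / r) := by ring
            rw [h2, abs_lt] at this
            have h3 : r / d * (d / r) = 1 := by field_simp
            have h4 : 0 < (d : ℝ) / r := by positivity
          · by_contra hh
            push Not at hh
            nlinarith [mul_lt_mul_of_pos_right hh h4]
          · by_contra hh
            push Not at hh
            nlinarith [mul_lt_mul_of_pos_right hh h4]
        have h5 : frobNorm (P.val - P₀.val) ^ 2 ≤ r ^ 2 := by
          rw [cc_frob_sq]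
          calc _ ≤ ∑ i : Fin d, ∑ j : Fin d, (r / d) ^ 2 :=
                Finset.sum_le_sum fun i _ => Finset.sum_le_sum fun j _ => h1 i j
            _ = r ^ 2 := by
                simp only [Finset.sum_const, Finset.card_univ, Fintype.card_fin, nsmul_eq_mul]
                field_simp
        exact le_of_sq_le_sq h5 hr.le
      calc σ.real (cell c) ≤ σ.real (ccB P₀ r) := measureReal_mono hsub
        _ = _ := by rw [Measure.real, Measure.real, cc_ball_eq σ hσ P₀ Q]
  calc σ.real (ccB Q (2 * r)) ≤ σ.real (⋃ c, cell c) := measureReal_mono hcov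
    _ ≤ ∑ c, σ.real (cell c) := measureReal_iUnion_fintype_le _
    _ ≤ ∑ c : T, σ.real (ccB Q r) := Finset.sum_le_sum fun c _ => hcell c
    _ = _ := by simp

noncomputable def ccG {k l : ℕ} (X : Matrix (Fin l) (Fin k) ℝ) : Matrix (Fin k ⊕ Fin l) (Fin k) ℝ :=
  fromRows (1 : Matrix (Fin k) (Fin k) ℝ) X

noncomputable def ccH {k l : ℕ} (Y : Matrix (Fin l) (Fin k) ℝ) : Matrix (Fin k ⊕ Fin l) (Fin l) ℝ :=
  fromRows (-Yᵀ) (1 : Matrix (Fin l) (Fin l) ℝ)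

noncomputable def ccProj {k l : ℕ} (X : Matrix (Fin l) (Fin k) ℝ) :
    Matrix (Fin k ⊕ Fin l) (Fin k ⊕ Fin l) ℝ :=
  ccG X * ((ccG X)ᵀ * ccG X)⁻¹ * (ccG X)ᵀ

lemma cc_gram_unit {k l : ℕ} (X : Matrix (Fin l) (Fin k) ℝ) :
    IsUnit ((ccG X)ᵀ * ccG X).det := by
  rw [ccG, transpose_fromRows, fromCols_mul_fromRows]
  have h : ((1 : Matrix (Fin k) (Fin k) ℝ)ᵀ * 1 + Xᵀ * X).PosDef := by
    refine Matrix.PosDef.add_posSemidef ?_ ?_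
    · simpa using Matrix.PosDef.one
    · simpa using Matrix.posSemidef_conjTranspose_mul_self X
  exact isUnit_iff_ne_zero.mpr h.det_pos.ne'

lemma cc_proj_mul {k l : ℕ} (X : Matrix (Fin l) (Fin k) ℝ) :
    ccProj X * ccG X = ccG X := by
  unfold ccProj
  rw [Matrix.mul_assoc, Matrix.mul_assoc, Matrix.nonsing_inv_mul _ (cc_gram_unit X),
    Matrix.mul_one]

lemma cc_proj_symm {k l : ℕ} (X : Matrix (Fin l) (Fin k) ℝ) : (ccProj X)ᵀ = ccProj X := by
  unfold ccProj
  simp only [Matrix.transpose_mul, Matrix.transpose_transpose, Matrix.transpose_nonsing_inv,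
    Matrix.mul_assoc]

lemma cc_proj_idem {k l : ℕ} (X : Matrix (Fin l) (Fin k) ℝ) : ccProj X * ccProj X = ccProj X := by
  conv_lhs => rhs; unfold ccProj
  rw [← Matrix.mul_assoc, ← Matrix.mul_assoc, cc_proj_mul]
  rfl

lemma cc_proj_trace {k l : ℕ} (X : Matrix (Fin l) (Fin k) ℝ) : (ccProj X).trace = k := by
  unfold ccProj
  rw [Matrix.trace_mul_cycle, Matrix.mul_nonsing_inv _ (cc_gram_unit X)]
  simp

lemma cc_proj_sep {k l : ℕ} (X Y : Matrix (Fin l) (Fin k) ℝ) :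
    (ccH Y)ᵀ * (ccProj X - ccProj Y) * ccG X
      = X - Y := by
  have h1 : (ccH Y)ᵀ * ccProj Y = 0 := by
    unfold ccProj
    rw [← Matrix.mul_assoc, ← Matrix.mul_assoc, ccH, ccG, transpose_fromRows, fromCols_mul_fromRows]
    simp
  rw [Matrix.mul_sub, h1, sub_zero, Matrix.mul_assoc, cc_proj_mul, ccH, ccG, transpose_fromRows,
    fromCols_mul_fromRows]
  simp
  abel

lemma cc_packing {d k : ℕ} (hkd : k ≤ d) (hd : 0 < d) : ∃ c : ℝ, 0 < c ∧ ∀ m : ℕ, 1 ≤ m →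
    ∃ f : (Fin (d - k) → Fin k → Fin m) → Grass d k,
      ∀ x y, x ≠ y → c / m ≤ frobNorm ((f x).val - (f y).val) := by
  let e : Fin k ⊕ Fin (d - k) ≃ Fin d :=
    finSumFinEquiv.trans (finCongr (by omega))
  have hdR : (0 : ℝ) < d := by exact_mod_cast hd
  refine ⟨1 / d ^ 2, by positivity, fun m hm => ?_⟩
  have hmR : (0 : ℝ) < m := by exact_mod_cast hm
  let mat : (Fin (d - k) → Fin k → Fin m) → Matrix (Fin (d - k)) (Fin k) ℝ :=
    fun x => Matrix.of fun i j => ((x i j : ℕ) : ℝ) / m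
  have hmat : ∀ x i j, |mat x i j| ≤ 1 := by
    intro x i j
    simp only [mat, Matrix.of_apply]
    rw [abs_of_nonneg (by positivity), div_le_one hmR]
    exact_mod_cast (x i j).2.le
  have hmem : ∀ x, (ccProj (mat x)).submatrix e.symm e.symm ∈ Grass d k := by
    intro x
    refine ⟨?_, ?_, ?_⟩
    · unfold Matrix.IsSymm
      rw [Matrix.transpose_submatrix, cc_proj_symm]
    · rw [Matrix.submatrix_mul_equiv, cc_proj_idem]
    · rw [← cc_proj_trace (mat x)]
      simp only [Matrix.trace, Matrix.diag, Matrix.submatrix_apply]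
      exact Equiv.sum_comp e.symm (fun i => ccProj (mat x) i i)
  refine ⟨fun x => ⟨_, hmem x⟩, fun x y hxy => ?_⟩
  set A : Matrix (Fin d) (Fin d) ℝ := (ccProj (mat x)).submatrix e.symm e.symm -
    (ccProj (mat y)).submatrix e.symm e.symm with hA
  change 1 / (d : ℝ) ^ 2 / m ≤ frobNorm A
  obtain ⟨i, j, hij⟩ : ∃ i j, x i j ≠ y i j := by
    by_contra hh
    push Not at hh
    exact hxy (funext fun i => funext fun j => hh i j)
  have hsep : 1 / (m : ℝ) ≤ |mat x i j - mat y i j| := by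
    simp only [mat, Matrix.of_apply]
    rw [← sub_div, abs_div, abs_of_pos hmR]
    gcongr
    have h1 : ((x i j : ℕ) : ℤ) - ((y i j : ℕ) : ℤ) ≠ 0 := by
      intro h
      apply hij
      apply Fin.ext
      omega
    exact_mod_cast Int.one_le_abs h1
  have hB : ∀ a b, |(ccProj (mat x) - ccProj (mat y)) a b| ≤ frobNorm A := by
    intro a b
    have := cc_frob_entry A (e a) (e b)
    simpa [hA] using this
  have hG : ∀ a, |ccG (mat x) a j| ≤ 1 := by
    rintro (a | a)
    · simp only [ccG, ccH, fromRows_apply_inl, Matrix.one_apply]; split_ifs <;> simp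
    · simp only [ccG, ccH, fromRows_apply_inr]; exact hmat _ _ _
  have hH : ∀ a, |ccH (mat y) a i| ≤ 1 := by
    rintro (a | a)
    · simp only [ccG, ccH, fromRows_apply_inl, Matrix.neg_apply, Matrix.transpose_apply, abs_neg]
      exact hmat _ _ _
    · simp only [ccG, ccH, fromRows_apply_inr, Matrix.one_apply]; split_ifs <;> simp
  have hkey := congrFun (congrFun (cc_proj_sep (mat x) (mat y)) i) j
  rw [Matrix.sub_apply, Matrix.mul_apply] at hkey
  have hcard : (Fintype.card (Fin k ⊕ Fin (d - k)) : ℝ) = d := by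
    rw [Fintype.card_congr e, Fintype.card_fin]
  have hbound : |mat x i j - mat y i j| ≤ d ^ 2 * frobNorm A := by
    rw [← hkey]
    calc _ ≤ ∑ b : Fin k ⊕ Fin (d - k), ∑ a : Fin k ⊕ Fin (d - k), frobNorm A := by
          refine (Finset.abs_sum_le_sum_abs _ _).trans (Finset.sum_le_sum fun b _ => ?_)
          rw [abs_mul, Matrix.mul_apply]
          refine (mul_le_of_le_one_right (abs_nonneg _) (hG b)).trans ?_
          refine (Finset.abs_sum_le_sum_abs _ _).trans (Finset.sum_le_sum fun a _ => ?_)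
          rw [abs_mul, Matrix.transpose_apply]
          exact (mul_le_of_le_one_left (abs_nonneg _) (hH a)).trans (hB a b)
      _ = _ := by
          simp only [Finset.sum_const, Finset.card_univ, nsmul_eq_mul, hcard]
          ring
  have := hsep.trans hbound
  rw [div_div, div_le_iff₀ (by positivity)]
  rw [div_le_iff₀ hmR] at this
  linarith

/-- Dirichlet kernel as a polynomial in the cosine. -/
noncomputable def ccD (N : ℕ) : Polynomial ℝ :=
  1 + Polynomial.C 2 * ∑ j ∈ Finset.range N, Polynomial.Chebyshev.T ℝ ((j : ℤ) + 1)

lemma ccD_natDegree (N : ℕ) : (ccD N).natDegree ≤ N := by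
  unfold ccD
  refine Polynomial.natDegree_add_le_of_degree_le (by simp) ?_
  refine (Polynomial.natDegree_C_mul_le _ _).trans ?_
  refine Polynomial.natDegree_sum_le_of_forall_le _ _ fun j hj => ?_
  rw [Polynomial.Chebyshev.natDegree_T]
  rw [Finset.mem_range] at hj
  omega

lemma ccD_cos (N : ℕ) (θ : ℝ) :
    (ccD N).eval (Real.cos θ) = 1 + 2 * ∑ j ∈ Finset.range N, Real.cos ((j + 1) * θ) := by
  unfold ccD
  simp [Polynomial.eval_finsetSum, Polynomial.Chebyshev.T_real_cos]

lemma ccD_sin (N : ℕ) (φ : ℝ) :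
    (ccD N).eval (Real.cos (2 * φ)) * Real.sin φ = Real.sin ((2 * N + 1) * φ) := by
  rw [ccD_cos]
  induction N with
  | zero => simp
  | succ n ih =>
    rw [Finset.sum_range_succ, mul_add, ← add_assoc, add_mul, ih]
    push_cast
    have e1 : (2 * ((n : ℝ) + 1) + 1) * φ = (n + 1) * (2 * φ) + φ := by ring
    have e2 : (2 * (n : ℝ) + 1) * φ = (n + 1) * (2 * φ) - φ := by ring
    rw [e1, e2, Real.sin_add, Real.sin_sub]
    ring

lemma cc_param {u : ℝ} (h0 : 0 ≤ u) (h1 : u ≤ 1) : ∃ φ : ℝ, 0 ≤ φ ∧ φ ≤ Real.pi / 2 ∧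
    Real.sin φ = √u ∧ Real.cos (2 * φ) = 1 - 2 * u := by
  have hs : Real.sin (Real.arcsin √u) = √u :=
    Real.sin_arcsin (by linarith [Real.sqrt_nonneg u]) (Real.sqrt_le_one.mpr h1)
  refine ⟨Real.arcsin √u, Real.arcsin_nonneg.mpr (Real.sqrt_nonneg _), Real.arcsin_le_pi_div_two _,
    hs, ?_⟩
  rw [Real.cos_two_mul', Real.cos_sq', hs, Real.sq_sqrt h0]
  ring

lemma ccD_upper (N : ℕ) {u : ℝ} (h0 : 0 ≤ u) (h1 : u ≤ 1) :
    ((ccD N).eval (1 - 2 * u)) ^ 2 * u ≤ 1 := by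
  obtain ⟨φ, -, -, hs, hc⟩ := cc_param h0 h1
  have h := ccD_sin N φ
  rw [hc, hs] at h
  have : ((ccD N).eval (1 - 2 * u)) ^ 2 * u = (Real.sin ((2 * N + 1) * φ)) ^ 2 := by
    rw [← h, mul_pow, Real.sq_sqrt h0]
  rw [this]
  exact Real.sin_sq_le_one _

lemma ccD_lower (N : ℕ) {u : ℝ} (h0 : 0 ≤ u) (h1 : u ≤ 1 / (9 * ((N : ℝ) + 1) ^ 2)) :
    (N : ℝ) + 1 ≤ (ccD N).eval (1 - 2 * u) := by
  have hN : (0 : ℝ) ≤ N := Nat.cast_nonneg N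
  have hu1 : u ≤ 1 := by
    refine h1.trans ?_
    rw [div_le_one (by positivity)]
    nlinarith
  obtain ⟨φ, hφ0, hφ1, hs, hc⟩ := cc_param h0 hu1
  have hsq : √u ≤ 1 / (3 * ((N : ℝ) + 1)) := by
    rw [Real.sqrt_le_left (by positivity)]
    refine h1.trans (le_of_eq ?_)
    rw [div_pow]; ring
  have hpi := Real.pi_pos
  have hφ : φ ≤ Real.pi / (6 * ((N : ℝ) + 1)) := by
    have h2 := Real.mul_le_sin hφ0 hφ1
    rw [hs] at h2
    have h3 := h2.trans hsq
    have h4 : φ = Real.pi / 2 * (2 / Real.pi * φ) := by field_simp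
    rw [h4]
    calc _ ≤ Real.pi / 2 * (1 / (3 * ((N : ℝ) + 1))) := by gcongr
      _ = _ := by field_simp; norm_num
  rw [← hc, ccD_cos]
  have hterm : ∀ j ∈ Finset.range N, (1 / 2 : ℝ) ≤ Real.cos ((j + 1) * (2 * φ)) := by
    intro j hj
    rw [Finset.mem_range] at hj
    have hj' : (j : ℝ) + 1 ≤ N + 1 := by exact_mod_cast (by omega : j + 1 ≤ N + 1)
    rw [← Real.cos_pi_div_three]
    apply Real.cos_le_cos_of_nonneg_of_le_pi (by positivity) (by linarith)
    calc ((j : ℝ) + 1) * (2 * φ) ≤ (N + 1) * (2 * (Real.pi / (6 * ((N : ℝ) + 1)))) := by gcongr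
      _ = Real.pi / 3 := by field_simp; norm_num
  have := Finset.sum_le_sum hterm
  simp only [Finset.sum_const, Finset.card_range, nsmul_eq_mul] at this
  linarith

lemma cc_pos {Ω : Type*} [MeasurableSpace Ω] (σ : Measure Ω) [IsProbabilityMeasure σ]
    (u D : Ω → ℝ) (hu : Measurable u) (hD : Measurable D) (B : ℝ) (hB : ∀ x, |D x| ≤ B)
    (h0 : ∀ x, 0 ≤ u x) (h1 : ∀ x, u x ≤ 1) (a M : ℝ) (K m J : ℕ) (hM : 1 ≤ M)
    (ha : a = 1 / (9 * M ^ 2)) (hK : 1 ≤ K)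
    (hdoub : ∀ j : ℕ, σ.real {x | u x ≤ 4 ^ (j + 1) * a} ≤ K * σ.real {x | u x ≤ 4 ^ j * a})
    (hlow : ∀ x, u x ≤ a → M ≤ D x) (hup : ∀ x, (D x) ^ 2 * u x ≤ 1)
    (hm : 2 * K ≤ 4 ^ m) (hJ : 2 * K * 9 ^ (m + 1) + 1 < 4 ^ J) :
    0 < ∫ x, (4 ^ J * a - u x) * (D x) ^ (2 * (m + 1)) ∂σ := by
  classical
  have hM0 : 0 < M := by linarith
  have ha0 : 0 < a := by rw [ha]; positivity
  have hKR : (1 : ℝ) ≤ K := by exact_mod_cast hK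
  let S : ℕ → Set Ω := fun j => {x | u x ≤ 4 ^ j * a}
  have hSm : ∀ j, MeasurableSet (S j) := fun j => measurableSet_le hu measurable_const
  obtain ⟨R, hR⟩ := pow_unbounded_of_one_lt (1 / a) (by norm_num : (1 : ℝ) < 4)
  have hR' : 1 < 4 ^ R * a := by rwa [div_lt_iff₀ ha0] at hR
  set b := σ.real (S 0) with hb
  have hS : ∀ j, σ.real (S j) ≤ K ^ j * b := by
    intro j
    induction j with
    | zero => simp [hb]
    | succ j ih =>
      calc σ.real (S (j + 1)) ≤ K * σ.real (S j) := hdoub j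
        _ ≤ K * (K ^ j * b) := by gcongr
        _ = _ := by ring
  have hb0 : 0 < b := by
    have h2 : S R = Set.univ := by
      ext x
      simp only [S, Set.mem_ofPred_eq, Set.mem_univ, iff_true]
      linarith [h1 x]
    have h3 := hS R
    rw [h2, probReal_univ] at h3
    by_contra hh
    push Not at hh
    have : (K : ℝ) ^ R * b ≤ 0 := mul_nonpos_of_nonneg_of_nonpos (by positivity) hh
    linarith
  let c0 : ℝ := (4 ^ J * a - a) * M ^ (2 * (m + 1))
  let c : ℕ → ℝ := fun j => ((4 ^ (J + j) * a) ^ m)⁻¹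
  let g : Ω → ℝ := fun x => (S 0).indicator (fun _ => c0) x -
    ∑ j ∈ Finset.range R, (S (J + j + 1)).indicator (fun _ => c j) x
  have hc : ∀ j, 0 ≤ c j := fun j => by positivity
  have hJ1 : (1 : ℝ) ≤ 4 ^ J := one_le_pow₀ (by norm_num)
  have hpt : ∀ x, g x ≤ (4 ^ J * a - u x) * (D x) ^ (2 * (m + 1)) := by
    intro x
    have hDn : 0 ≤ (D x) ^ (2 * (m + 1)) := by rw [pow_mul]; positivity
    have hsum0 : 0 ≤ ∑ j ∈ Finset.range R, (S (J + j + 1)).indicator (fun _ => c j) x :=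
      Finset.sum_nonneg fun j _ => Set.indicator_nonneg (fun _ _ => hc j) x
    by_cases hx : u x ≤ 4 ^ J * a
    · by_cases hx0 : x ∈ S 0
      · have hxa : u x ≤ a := by simpa [S] using hx0
        have : c0 ≤ (4 ^ J * a - u x) * (D x) ^ (2 * (m + 1)) := by
          have := hlow x hxa
          have h4 : 0 ≤ 4 ^ J * a - u x := by linarith
          simp only [c0]
          gcongr
        simp only [g, Set.indicator_of_mem hx0]
        linarith
      · simp only [g, Set.indicator_of_notMem hx0]
        have : 0 ≤ (4 ^ J * a - u x) * (D x) ^ (2 * (m + 1)) := mul_nonneg (by linarith) hDn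
        linarith
    · push Not at hx
      have hx0 : x ∉ S 0 := by
        simp only [S, Set.mem_ofPred_eq, pow_zero, one_mul, not_le]
        nlinarith
      -- find the scale
      have hex : ∃ j, u x ≤ 4 ^ (J + j + 1) * a := by
        refine ⟨R, (h1 x).trans (hR'.le.trans ?_)⟩
        gcongr
        · norm_num
        · omega
      let j := Nat.find hex
      have hj : u x ≤ 4 ^ (J + j + 1) * a := Nat.find_spec hex
      have hj2 : 4 ^ (J + j) * a < u x := by
        rcases Nat.eq_zero_or_pos j with h | h
        · rw [h]; simpa using hx
        · have := Nat.find_min hex (m := j - 1) (by omega)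
          push Not at this
          rwa [show J + (j - 1) + 1 = J + j by omega] at this
      have hjR : j < R := by
        by_contra hh
        push Not at hh
        have : (4 : ℝ) ^ R * a ≤ 4 ^ (J + j) * a := by
          gcongr
          · norm_num
          · omega
        linarith [h1 x]
      have hge : c j ≤ ∑ j ∈ Finset.range R, (S (J + j + 1)).indicator (fun _ => c j) x := by
        have h5 := Finset.single_le_sum (f := fun j => (S (J + j + 1)).indicator (fun _ => c j) x)
          (fun j _ => Set.indicator_nonneg (fun _ _ => hc j) x) (Finset.mem_range.mpr hjR)
        have h6 : x ∈ S (J + j + 1) := hj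
        simpa only [Set.indicator_of_mem h6] using h5
      simp only [g, Set.indicator_of_notMem hx0]
      have hux : 0 < u x := lt_trans (by positivity) hj2
      have h7 : (u x - 4 ^ J * a) * (D x) ^ (2 * (m + 1)) ≤ c j := by
        calc _ ≤ u x * (D x) ^ (2 * (m + 1)) := by
              gcongr
              linarith [show 0 < 4 ^ J * a by positivity]
          _ = ((D x) ^ 2 * u x) ^ (m + 1) * (u x ^ m)⁻¹ := by
              rw [mul_pow, ← pow_mul, pow_succ (u x)]
              field_simp
          _ ≤ 1 * (u x ^ m)⁻¹ := by
              gcongr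
              exact pow_le_one₀ (by positivity) (hup x)
          _ ≤ c j := by
              rw [one_mul]
              simp only [c]
              gcongr
      linarith
  have hgi1 : Integrable ((S 0).indicator (fun _ => c0)) σ :=
    (integrable_const c0).indicator (hSm 0)
  have hgi2 : ∀ j ∈ Finset.range R, Integrable ((S (J + j + 1)).indicator (fun _ => c j)) σ :=
    fun j _ => (integrable_const (c j)).indicator (hSm _)
  have hgi : Integrable g σ := hgi1.sub (integrable_finsetSum _ hgi2)
  have hint : Integrable (fun x => (4 ^ J * a - u x) * (D x) ^ (2 * (m + 1))) σ := by
    refine Integrable.of_bound (by fun_prop) ((4 ^ J * a + 1) * B ^ (2 * (m + 1))) ?_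
    refine Filter.Eventually.of_forall fun x => ?_
    rw [Real.norm_eq_abs, abs_mul, abs_pow]
    have h8 : |4 ^ J * a - u x| ≤ 4 ^ J * a + 1 := by
      have : 0 < 4 ^ J * a := by positivity
      rw [abs_le]; constructor <;> linarith [h0 x, h1 x]
    have := hB x
    gcongr
  have hval : ∫ x, g x ∂σ = c0 * b - ∑ j ∈ Finset.range R, c j * σ.real (S (J + j + 1)) := by
    simp only [g]
    rw [integral_sub hgi1 (integrable_finsetSum _ hgi2), integral_finsetSum _ hgi2,
      integral_indicator_const _ (hSm 0)]
    congr 1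
    · rw [smul_eq_mul, mul_comm]
    · refine Finset.sum_congr rfl fun j _ => ?_
      rw [integral_indicator_const _ (hSm _), smul_eq_mul, mul_comm]
  refine lt_of_lt_of_le ?_ (integral_mono hgi hint hpt)
  rw [hval, sub_pos]
  have hmR : 2 * (K : ℝ) ≤ 4 ^ m := by exact_mod_cast hm
  have hJR : 2 * (K : ℝ) * 9 ^ (m + 1) + 1 < 4 ^ J := by exact_mod_cast hJ
  have hterm : ∀ j ∈ Finset.range R, c j * σ.real (S (J + j + 1)) ≤
      (a ^ m)⁻¹ * K * b * (1 / 2) ^ j := by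
    intro j _
    have h9 : (K : ℝ) ^ (J + j) * (((4 : ℝ) ^ m) ^ (J + j))⁻¹ ≤ (1 / 2) ^ j := by
      rw [← inv_pow, ← mul_pow]
      calc _ ≤ (1 / 2 : ℝ) ^ (J + j) := by
            gcongr
            rw [← div_eq_mul_inv, div_le_div_iff₀ (by positivity) (by norm_num)]
            linarith
        _ ≤ _ := pow_le_pow_of_le_one (by norm_num) (by norm_num) (by omega)
    calc c j * σ.real (S (J + j + 1)) ≤ c j * (K ^ (J + j + 1) * b) := by
          exact mul_le_mul_of_nonneg_left (hS _) (hc j)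
      _ = (a ^ m)⁻¹ * K * b * ((K : ℝ) ^ (J + j) * (((4 : ℝ) ^ m) ^ (J + j))⁻¹) := by
          simp only [c]
          rw [mul_pow, mul_inv, ← pow_mul, ← pow_mul, mul_comm m, pow_succ]
          ring
      _ ≤ _ := by gcongr
  have hgeom : ∑ j ∈ Finset.range R, (1 / 2 : ℝ) ^ j ≤ 2 := sum_geometric_two_le R
  calc ∑ j ∈ Finset.range R, c j * σ.real (S (J + j + 1))
      ≤ ∑ j ∈ Finset.range R, (a ^ m)⁻¹ * K * b * (1 / 2) ^ j := Finset.sum_le_sum hterm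
    _ = (a ^ m)⁻¹ * K * b * ∑ j ∈ Finset.range R, (1 / 2) ^ j := by rw [Finset.mul_sum]
    _ ≤ (a ^ m)⁻¹ * K * b * 2 := by gcongr
    _ < c0 * b := by
        have hMa : M ^ (2 * (m + 1)) = ((9 : ℝ) ^ (m + 1))⁻¹ * (a ^ (m + 1))⁻¹ := by
          rw [← mul_inv, ← mul_pow, ha, pow_mul, ← inv_pow]
          congr 1
          field_simp
        have h10 : c0 = (4 ^ J - 1) * ((9 : ℝ) ^ (m + 1))⁻¹ * (a ^ m)⁻¹ := by
          simp only [c0]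
          rw [hMa, pow_succ a]
          field_simp
        rw [h10]
        have h11 : 2 * (K : ℝ) < (4 ^ J - 1) * ((9 : ℝ) ^ (m + 1))⁻¹ := by
          rw [← div_eq_mul_inv, lt_div_iff₀ (by positivity)]
          linarith
        have h12 : 0 < (a ^ m)⁻¹ * b := by positivity
        nlinarith [mul_lt_mul_of_pos_right h11 h12]

lemma cc_homog {d k : ℕ} (hk : 1 ≤ k) (Q : Grass d k) (p : Polynomial ℝ) (t : ℕ)
    (hp : p.natDegree ≤ t) :
    ∃ F ∈ MvPolynomial.homogeneousSubmodule (Fin d × Fin d) ℝ t, ∀ P : Grass d k,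
      MvPolynomial.eval (fun ij => (P : Matrix (Fin d) (Fin d) ℝ) ij.1 ij.2) F
        = p.eval (1 - 2 * ccU Q P) := by
  have hkR : (0 : ℝ) < k := by exact_mod_cast hk
  let τ : MvPolynomial (Fin d × Fin d) ℝ := MvPolynomial.C (1 / (k : ℝ)) *
    ∑ i : Fin d, MvPolynomial.X (i, i)
  let L : MvPolynomial (Fin d × Fin d) ℝ := MvPolynomial.C (2 / (k : ℝ)) *
    (∑ i : Fin d, ∑ j : Fin d, MvPolynomial.C (Q.val j i) * MvPolynomial.X (i, j)) - τ
  have hτ : τ.IsHomogeneous 1 := by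
    have := (MvPolynomial.isHomogeneous_C (Fin d × Fin d) (1 / (k : ℝ))).mul
      (MvPolynomial.IsHomogeneous.sum (Finset.univ : Finset (Fin d))
        (fun i => (MvPolynomial.X (i, i) : MvPolynomial (Fin d × Fin d) ℝ)) 1
        (fun i _ => MvPolynomial.isHomogeneous_X ℝ _))
    rwa [zero_add] at this
  have hL : L.IsHomogeneous 1 := by
    refine MvPolynomial.IsHomogeneous.sub ?_ hτ
    have h1 : (∑ i : Fin d, ∑ j : Fin d, MvPolynomial.C (Q.val j i) *
        (MvPolynomial.X (i, j) : MvPolynomial (Fin d × Fin d) ℝ)).IsHomogeneous 1 := by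
      refine MvPolynomial.IsHomogeneous.sum _ _ 1 fun i _ =>
        MvPolynomial.IsHomogeneous.sum _ _ 1 fun j _ => ?_
      simpa using (MvPolynomial.isHomogeneous_C (Fin d × Fin d) (Q.val j i)).mul
        (MvPolynomial.isHomogeneous_X ℝ (i, j))
    simpa using (MvPolynomial.isHomogeneous_C (Fin d × Fin d) (2 / (k : ℝ))).mul h1
  refine ⟨∑ i ∈ Finset.range (t + 1), MvPolynomial.C (p.coeff i) * (L ^ i * τ ^ (t - i)), ?_, ?_⟩
  · rw [MvPolynomial.mem_homogeneousSubmodule]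
    refine MvPolynomial.IsHomogeneous.sum _ _ t fun i hi => ?_
    rw [Finset.mem_range] at hi
    have h1 := (hL.pow i).mul (hτ.pow (t - i))
    have h2 := (MvPolynomial.isHomogeneous_C (Fin d × Fin d) (p.coeff i)).mul h1
    rwa [show 0 + (1 * i + 1 * (t - i)) = t by omega] at h2
  · intro P
    have e1 : MvPolynomial.eval (fun ij => (P : Matrix (Fin d) (Fin d) ℝ) ij.1 ij.2) τ = 1 := by
      have := P.property.2.2
      simp only [Matrix.trace, Matrix.diag] at this
      simp only [τ, map_mul, map_sum, MvPolynomial.eval_C, MvPolynomial.eval_X, this]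
      field_simp
    have e2 : MvPolynomial.eval (fun ij => (P : Matrix (Fin d) (Fin d) ℝ) ij.1 ij.2) L
        = 1 - 2 * ccU Q P := by
      have h3 : (P.val * Q.val).trace = ∑ i, ∑ j, Q.val j i * P.val i j := by
        simp only [Matrix.trace, Matrix.diag, Matrix.mul_apply]
        exact Finset.sum_congr rfl fun i _ => Finset.sum_congr rfl fun j _ => mul_comm _ _
      simp only [L, map_sub, e1, map_mul, map_sum, MvPolynomial.eval_C, MvPolynomial.eval_X]
      rw [← h3, ccU, cc_dist_sq]
      field_simp
      ring
    simp only [map_sum, map_mul, map_pow, e1, e2, MvPolynomial.eval_C, one_pow, mul_one]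
    rw [Polynomial.eval_eq_sum_range' (Nat.lt_succ_of_le hp)]

lemma ccU_nonneg {d k : ℕ} (Q P : Grass d k) : 0 ≤ ccU Q P := by
  unfold ccU; positivity

lemma ccU_le_one {d k : ℕ} (Q P : Grass d k) : ccU Q P ≤ 1 := by
  unfold ccU
  exact div_le_one_of_le₀ (cc_dist_sq_le P Q) (by positivity)

lemma ccU_set {d k : ℕ} (hk : 1 ≤ k) (Q : Grass d k) (a : ℝ) (ha : 0 < a) (j : ℕ) :
    {P | ccU Q P ≤ 4 ^ j * a} = ccB Q (2 ^ j * √(2 * k * a)) := by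
  have hkR : (0 : ℝ) < k := by exact_mod_cast hk
  ext P
  simp only [ccB, ccU, Set.mem_ofPred_eq]
  rw [div_le_iff₀ (by positivity), ← sq_le_sq₀ (cc_frob_nonneg _) (by positivity), mul_pow,
    Real.sq_sqrt (by positivity), ← pow_mul, mul_comm j, pow_mul]
  norm_num
  rw [show (4 : ℝ) ^ j * a * (2 * k) = 4 ^ j * (2 * k * a) by ring]

lemma cc_upper (d k : ℕ) (hk1 : 1 ≤ k) (hd : 0 < d)
    (σ : Measure (Grass d k)) [IsProbabilityMeasure σ] (hσ : IsOrthInvariant σ) :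
    ∃ C : ℝ, 0 < C ∧ ∀ (t n : ℕ), 1 ≤ t → ∀ (P : Fin n → Grass d k) (ω : Fin n → ℝ),
        (∀ j, 0 < ω j) → IsCubature σ P ω t → covRadius P ≤ C / t := by
  have hkR : (0 : ℝ) < k := by exact_mod_cast hk1
  obtain ⟨K, hK, hdoub⟩ := cc_doubling hd σ hσ
  obtain ⟨m, hm⟩ := pow_unbounded_of_one_lt (2 * K) (by norm_num : 1 < 4)
  obtain ⟨J, hJ⟩ := pow_unbounded_of_one_lt (2 * K * 9 ^ (m + 1) + 1) (by norm_num : 1 < 4)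
  refine ⟨√(2 * k * 4 ^ J * (4 * ((m : ℝ) + 1) ^ 2) / 9), by positivity, ?_⟩
  intro t n ht P ω hω hcub
  have htR : (0 : ℝ) < t := by exact_mod_cast ht
  let N := (t - 1) / (2 * (m + 1))
  have hN1 : 2 * (m + 1) * N + 1 ≤ t := by
    have := Nat.mul_div_le (t - 1) (2 * (m + 1))
    have h : 2 * (m + 1) * N ≤ t - 1 := this
    omega
  have hN2 : t ≤ 2 * (m + 1) * (N + 1) := by
    have := Nat.lt_mul_div_succ (t - 1) (show 0 < 2 * (m + 1) by omega)
    have h : t - 1 < 2 * (m + 1) * (N + 1) := this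
    omega
  have hN2R : (t : ℝ) ≤ 2 * ((m : ℝ) + 1) * ((N : ℝ) + 1) := by exact_mod_cast hN2
  set M : ℝ := (N : ℝ) + 1 with hM
  have hM1 : 1 ≤ M := by have : (0 : ℝ) ≤ N := Nat.cast_nonneg N
                         linarith
  set a : ℝ := 1 / (9 * M ^ 2) with ha
  have ha0 : 0 < a := by positivity
  obtain ⟨Q₀⟩ : Nonempty (Grass d k) := nonempty_of_isProbabilityMeasure σ
  have : Nonempty (Grass d k) := ⟨Q₀⟩
  refine ciSup_le fun Q => ?_
  let p : Polynomial ℝ := (Polynomial.C (4 ^ J * a - 1 / 2) + Polynomial.C (1 / 2) * Polynomial.X) *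
    (ccD N) ^ (2 * (m + 1))
  have hpd : p.natDegree ≤ t := by
    refine Polynomial.natDegree_mul_le.trans ?_
    have h1 : (Polynomial.C (4 ^ J * a - 1 / 2) +
        Polynomial.C (1 / 2) * Polynomial.X : Polynomial ℝ).natDegree ≤ 1 := by
      compute_degree
    have h2 : ((ccD N) ^ (2 * (m + 1))).natDegree ≤ 2 * (m + 1) * N :=
      Polynomial.natDegree_pow_le.trans (Nat.mul_le_mul_left _ (ccD_natDegree N))
    omega
  have hpe : ∀ u : ℝ, p.eval (1 - 2 * u) =
      (4 ^ J * a - u) * ((ccD N).eval (1 - 2 * u)) ^ (2 * (m + 1)) := by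
    intro u
    simp only [p, Polynomial.eval_mul, Polynomial.eval_add, Polynomial.eval_C, Polynomial.eval_X,
      Polynomial.eval_pow]
    ring
  obtain ⟨F, hF, hFe⟩ := cc_homog hk1 Q p t hpd
  have hc := hcub F hF
  simp only [hFe, hpe] at hc
  have hUm : Measurable (ccU Q) := by
    unfold ccU
    exact ((cc_meas_dist Q).pow_const 2).div_const _
  obtain ⟨B, hB⟩ := (isCompact_Icc (a := (-1 : ℝ)) (b := 1)).exists_bound_of_continuousOn
    (f := fun x => (ccD N).eval x) (ccD N).continuous.continuousOn
  have hpos := cc_pos σ (ccU Q) (fun R => (ccD N).eval (1 - 2 * ccU Q R)) hUm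
    ((ccD N).continuous.measurable.comp (measurable_const.sub (hUm.const_mul 2))) B
    (fun R => hB _ ⟨by linarith [ccU_le_one Q R], by linarith [ccU_nonneg Q R]⟩)
    (ccU_nonneg Q) (ccU_le_one Q) a M K m J hM1 ha hK
    (fun j => by
      rw [ccU_set hk1 Q a ha0, ccU_set hk1 Q a ha0, pow_succ, mul_comm ((2 : ℝ) ^ j) 2, mul_assoc]
      exact hdoub Q _ (by positivity))
    (fun R hR => ccD_lower N (ccU_nonneg Q R) hR)
    (fun R => ccD_upper N (ccU_nonneg Q R) (ccU_le_one Q R))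
    hm.le hJ
  rw [hc] at hpos
  obtain ⟨j, -, hj⟩ := Finset.exists_lt_of_sum_lt (s := Finset.univ) (f := fun _ : Fin n => (0 : ℝ))
    (by simpa using hpos)
  have hlt : ccU Q (P j) < 4 ^ J * a := by
    by_contra hh
    push Not at hh
    have h1 : (4 ^ J * a - ccU Q (P j)) *
        ((ccD N).eval (1 - 2 * ccU Q (P j))) ^ (2 * (m + 1)) ≤ 0 := by
      refine mul_nonpos_of_nonpos_of_nonneg (by linarith) ?_
      rw [pow_mul]; positivity
    nlinarith [hω j]
  refine (ciInf_le (Set.finite_range _).bddBelow j).trans ?_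
  rw [cc_frob_comm, le_div_iff₀ htR]
  apply Real.le_sqrt_of_sq_le
  rw [ccU, div_lt_iff₀ (by positivity)] at hlt
  calc (frobNorm ((P j).val - Q.val) * t) ^ 2 = frobNorm ((P j).val - Q.val) ^ 2 * t ^ 2 := by ring
    _ ≤ (4 ^ J * a * (2 * k)) * (2 * ((m : ℝ) + 1) * M) ^ 2 := by gcongr
    _ = _ := by
      rw [ha]
      field_simp
      ring

lemma cc_cover {d k n : ℕ} (hn : 1 ≤ n) (P : Fin n → Grass d k) (Q : Grass d k) :
    ∃ j, Q ∈ ccB (P j) (covRadius P) := by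
  have : Nonempty (Fin n) := ⟨⟨0, hn⟩⟩
  obtain ⟨j, hj⟩ := exists_eq_ciInf_of_finite (f := fun j => frobNorm (Q.val - (P j).val))
  refine ⟨j, ?_⟩
  change frobNorm (Q.val - (P j).val) ≤ covRadius P
  rw [hj]
  refine le_ciSup (f := fun Q : Grass d k => ⨅ j, frobNorm (Q.val - (P j).val)) ?_ Q
  refine ⟨√(2 * k), ?_⟩
  rintro _ ⟨R, rfl⟩
  refine (ciInf_le (Set.finite_range _).bddBelow j).trans ?_
  exact Real.le_sqrt_of_sq_le (cc_dist_sq_le R (P j))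

lemma cc_lower (d k : ℕ) (hkd : k ≤ d) (hd : 0 < d)
    (σ : Measure (Grass d k)) [IsProbabilityMeasure σ] (hσ : IsOrthInvariant σ) :
    ∃ c : ℝ, 0 < c ∧ ∀ (m n : ℕ), 1 ≤ m → 1 ≤ n → ∀ (P : Fin n → Grass d k),
        n < m ^ (k * (d - k)) → c / m ≤ covRadius P := by
  classical
  obtain ⟨c, hc, hpack⟩ := cc_packing hkd hd
  refine ⟨c / 3, by positivity, fun m n hm hn P hnm => ?_⟩
  have hmR : (0 : ℝ) < m := by exact_mod_cast hm
  obtain ⟨f, hf⟩ := hpack m hm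
  by_contra hh
  push Not at hh
  set ρ := covRadius P with hρ
  obtain ⟨Q⟩ : Nonempty (Grass d k) := nonempty_of_isProbabilityMeasure σ
  have heq : ∀ R, σ.real (ccB R ρ) = σ.real (ccB Q ρ) := fun R => by
    rw [Measure.real, Measure.real, cc_ball_eq σ hσ R Q]
  have h1 : 1 ≤ n * σ.real (ccB Q ρ) := by
    have hcov : (⋃ j, ccB (P j) ρ) = Set.univ := by
      ext R; simpa using cc_cover hn P R
    calc (1 : ℝ) = σ.real (⋃ j, ccB (P j) ρ) := by rw [hcov, probReal_univ]
      _ ≤ ∑ j, σ.real (ccB (P j) ρ) := measureReal_iUnion_fintype_le _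
      _ = _ := by simp [heq]
  have h2 : (m : ℝ) ^ (k * (d - k)) * σ.real (ccB Q ρ) ≤ 1 := by
    have hdis : ((Finset.univ : Finset (Fin (d - k) → Fin k → Fin m)) :
        Set (Fin (d - k) → Fin k → Fin m)).PairwiseDisjoint (fun x => ccB (f x) ρ) := by
      intro x _ y _ hxy
      rw [Function.onFun, Set.disjoint_left]
      intro R hx hy
      have h3 := hf x y hxy
      have h4 := cc_frob_tri (f x).val R.val (f y).val
      rw [cc_frob_comm (f x).val R.val] at h4
      have hx' : frobNorm (R.val - (f x).val) ≤ ρ := hx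
      have hy' : frobNorm (R.val - (f y).val) ≤ ρ := hy
      have h5 : c / 3 / m = c / m / 3 := by ring
      have h6 : 0 < c / m := by positivity
      rw [h5] at hh
      linarith
    have h7 := measureReal_biUnion_finset (μ := σ) hdis (fun x _ => cc_meas_ball (f x) ρ)
    have h8 : σ.real (⋃ x ∈ (Finset.univ : Finset (Fin (d - k) → Fin k → Fin m)), ccB (f x) ρ) ≤ 1 :=
      measureReal_le_one
    rw [h7] at h8
    simpa [heq, ← pow_mul] using h8
  have h3 : (n : ℝ) < (m : ℝ) ^ (k * (d - k)) := by exact_mod_cast hnm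
  have h4 : 0 < σ.real (ccB Q ρ) := by
    by_contra hneg
    push Not at hneg
    have : (n : ℝ) * σ.real (ccB Q ρ) ≤ 0 :=
      mul_nonpos_of_nonneg_of_nonpos (Nat.cast_nonneg n) hneg
    linarith
  nlinarith [mul_lt_mul_of_pos_right h3 h4]

/-- There is a constant `C > 0` (depending only on `d`, `k`) such that every
cubature for `Hom_t(G_{k,d})` with positive weights has covering radius at most `C/t`; in
particular, any sequence of such cubatures of cardinalities `n_t ≍ t^{k(d−k)}` is an
asymptotically optimal covering: `ρ^{(t)} ≍ n_t^{−1/(k(d−k))}`. -/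
theorem cubature_covering_radius (d k : ℕ) (hk1 : 1 ≤ k) (hkd : k ≤ d - 1)
    (σ : Measure (Grass d k)) [IsProbabilityMeasure σ] (hσ : IsOrthInvariant σ) :
    (∃ C : ℝ, 0 < C ∧ ∀ (t n : ℕ), 1 ≤ t → ∀ (P : Fin n → Grass d k) (ω : Fin n → ℝ),
        (∀ j, 0 < ω j) → IsCubature σ P ω t → covRadius P ≤ C / t) ∧
      ∀ (N : ℕ → ℕ) (P : ∀ t : ℕ, Fin (N t) → Grass d k) (ω : ∀ t : ℕ, Fin (N t) → ℝ),
        (∀ t : ℕ, 1 ≤ t → (∀ j, 0 < ω t j) ∧ IsCubature σ (P t) (ω t) t) →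
        (∃ c₁ c₂ : ℝ, 0 < c₁ ∧ 0 < c₂ ∧ ∀ t : ℕ, 1 ≤ t →
          c₁ * (t : ℝ) ^ (k * (d - k)) ≤ (N t : ℝ) ∧
            (N t : ℝ) ≤ c₂ * (t : ℝ) ^ (k * (d - k))) →
        ∃ c₁ c₂ : ℝ, 0 < c₁ ∧ 0 < c₂ ∧ ∀ t : ℕ, 1 ≤ t →
          c₁ * (N t : ℝ) ^ (-(1 : ℝ) / ((k * (d - k) : ℕ) : ℝ)) ≤ covRadius (P t) ∧
            covRadius (P t) ≤ c₂ * (N t : ℝ) ^ (-(1 : ℝ) / ((k * (d - k) : ℕ) : ℝ)) := by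

  have hd : 0 < d := by omega
  have hkd' : k ≤ d := by omega
  obtain ⟨C, hC, hup⟩ := cc_upper d k hk1 hd σ hσ
  refine ⟨⟨C, hC, hup⟩, ?_⟩
  intro N P ω hcub hN
  obtain ⟨a₁, a₂, ha₁, ha₂, hN⟩ := hN
  obtain ⟨c, hc, hlow⟩ := cc_lower d k hkd' hd σ hσ
  set D := k * (d - k) with hD
  have hD0 : D ≠ 0 := by
    have : 0 < d - k := by omega
    positivity
  have hDR : (0 : ℝ) < D := by positivity
  refine ⟨c / 2, C * a₂ ^ ((1 : ℝ) / D), by positivity, by positivity, fun t ht => ?_⟩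
  have htR : (0 : ℝ) < t := by exact_mod_cast ht
  have hN0 : (0 : ℝ) < N t := lt_of_lt_of_le (by positivity) (hN t ht).1
  have hN1 : 1 ≤ N t := by exact_mod_cast hN0
  set x : ℝ := (N t : ℝ) ^ ((1 : ℝ) / D) with hx
  have hx0 : 0 < x := by positivity
  have hx1 : 1 ≤ x := Real.one_le_rpow (by exact_mod_cast hN1) (by positivity)
  have hxD : x ^ D = N t := by
    rw [hx, one_div, Real.rpow_inv_natCast_pow hN0.le hD0]
  have hneg : (N t : ℝ) ^ (-(1 : ℝ) / D) = x⁻¹ := by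
    rw [neg_div, Real.rpow_neg hN0.le]
  rw [hneg]
  constructor
  · have hfl : x < (⌊x⌋₊ + 1 : ℕ) := by exact_mod_cast Nat.lt_floor_add_one x
    have hlt : N t < (⌊x⌋₊ + 1) ^ D := by
      have : (N t : ℝ) < ((⌊x⌋₊ + 1 : ℕ) : ℝ) ^ D := by
        rw [← hxD]; gcongr
      exact_mod_cast this
    refine le_trans ?_ (hlow (⌊x⌋₊ + 1) (N t) (by omega) hN1 (P t) hlt)
    have h2 : ((⌊x⌋₊ + 1 : ℕ) : ℝ) ≤ 2 * x := by
      push_cast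
      linarith [Nat.floor_le hx0.le]
    calc c / 2 * x⁻¹ = c / (2 * x) := by field_simp
      _ ≤ _ := by gcongr
  · refine (hup t (N t) ht (P t) (ω t) (hcub t ht).1 (hcub t ht).2).trans ?_
    have h1 : x ≤ a₂ ^ ((1 : ℝ) / D) * t := by
      calc x ≤ (a₂ * (t : ℝ) ^ D) ^ ((1 : ℝ) / D) :=
            Real.rpow_le_rpow hN0.le (hN t ht).2 (by positivity)
        _ = _ := by
            rw [Real.mul_rpow ha₂.le (by positivity), one_div,
              Real.pow_rpow_inv_natCast htR.le hD0]
    rw [← div_eq_mul_inv, div_le_div_iff₀ htR hx0]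
    nlinarith
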